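/- Let u,v ∈ S_n have separated descents at position k, let w ∈ S_n, and let 1≤i<n with ℓ(s_i w)>ℓ(w). Writing Z_{u,v}^w(t,y)=Σ_{π∈PP(u,v,w)} wt(π): if ℓ(s_i v)<ℓ(v) (so s_i v still has mindes ≥ k), then Z_{u,v}^{s_i w} = −((1+βt_{i+1})/(t_i−t_{i+1}))·Z_{u,v}^w|_{t_i↔t_{i+1}} + ((1+βt_i)/(t_i−t_{i+1}))·Z_{u,v}^w + Z_{u,s_i v}^w|_{t_i↔t_{i+1}}; if ℓ(s_i v)>ℓ(v), then Z_{u,v}^{s_i w} = −((1+βt_i)/(t_i−t_{i+1}))·Z_{u,v}^w|_{t_i↔t_{i+1}} + ((1+βt_i)/(t_i−t_{i+1}))·Z_{u,v}^w. -/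

import Mathlib

open MvPolynomial

noncomputable section

namespace BPDPuzzle

/-- `x ⊖ y = (x - y)/(1 + β·y)`. -/
def ominus {K : Type*} [Field K] (β a b : K) : K := (a - b) / (1 + β * b)

/-- A permutation of `ℕ` lying in `S_∞`, i.e. fixing all sufficiently large integers. -/
def FinPerm (w : Equiv.Perm ℕ) : Prop := ∃ N : ℕ, ∀ j, N ≤ j → w j = j

/-- A permutation of `ℕ` lying in `S_n` (0-based positions `0, …, n-1`). -/
def InSn (n : ℕ) (w : Equiv.Perm ℕ) : Prop := ∀ j, n ≤ j → w j = j

/-- Coxeter length: the number of inversions. -/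
def len (w : Equiv.Perm ℕ) : ℕ := Set.ncard {p : ℕ × ℕ | p.1 < p.2 ∧ w p.2 < w p.1}

/-- The simple transposition `s_i`, exchanging the (0-based) positions `i` and `i+1`. -/
def sTr (i : ℕ) : Equiv.Perm ℕ := Equiv.swap i (i + 1)

/-- `u` and `v` have separated descents at position `k`, i.e.
`maxdes(u) ≤ k ≤ mindes(v)` (in 0-based conventions: `u` has no descent at any
0-based position `≥ k` and `v` has no descent at any 0-based position `< k-1`). -/
def SepDesc (k : ℕ) (u v : Equiv.Perm ℕ) : Prop :=
  (∀ i, k ≤ i → u i ≤ u (i + 1)) ∧ (∀ i, i + 1 < k → v i ≤ v (i + 1))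

/-- The longest element `n ⋯ 2 1` of `S_n`, extended by the identity. -/
def revPerm (n : ℕ) : Equiv.Perm ℕ where
  toFun j := if j < n then n - 1 - j else j
  invFun j := if j < n then n - 1 - j else j
  left_inv j := by dsimp only; split_ifs <;> omega
  right_inv j := by dsimp only; split_ifs <;> omega

/-- Exchange the values of a valuation at the indices `i` and `i+1`. -/
def swapVal {K : Type*} (t : ℕ → K) (i : ℕ) : ℕ → K :=
  fun j => if j = i then t (i + 1) else if j = i + 1 then t i else t j

/-- The defining properties of the family of double Grothendieck polynomials
`𝔊_w(x, t)`, viewed as a family of polynomials in the `x`-variables depending on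
a valuation `t` of the second set of variables:  the initial condition
`𝔊_{n⋯21}(x,t) = ∏_{i+j≤n} (x_i ⊖ t_j)` together with the Demazure recursion
`π_i 𝔊_w = 𝔊_{w s_i}` whenever `w(i) > w(i+1)` (the latter written with the
denominator `x_i - x_{i+1}` cleared). -/
def GrothFamily {K : Type*} [Field K] (β : K)
    (G : (ℕ → K) → Equiv.Perm ℕ → MvPolynomial ℕ K) : Prop :=
  ∀ t : ℕ → K, (∀ j, 1 + β * t j ≠ 0) →
    (∀ n : ℕ, G t (revPerm n) =
      ∏ i ∈ Finset.range n, ∏ j ∈ Finset.range (n - 1 - i),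
        C ((1 + β * t j)⁻¹) * (X i - C (t j))) ∧
    (∀ (w : Equiv.Perm ℕ) (i : ℕ), w (i + 1) < w i →
      (X i - X (i + 1)) * G t (w * sTr i) =
        (1 + C β * X (i + 1)) * G t w
          - (1 + C β * X i) * rename ⇑(Equiv.swap i (i + 1)) (G t w))

/-- The defining property of the structure constants `c_{u,v}^w(t,y)`:
`𝔊_u(x,y) · 𝔊_v(x,t) = Σ_w c_{u,v}^w(t,y) · 𝔊_w(x,t)`, the (finitely supported)
sum ranging over the permutations `w ∈ S_∞`. -/
def StructConsts {K : Type*} [Field K] (β : K)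
    (G : (ℕ → K) → Equiv.Perm ℕ → MvPolynomial ℕ K)
    (c : (ℕ → K) → (ℕ → K) → Equiv.Perm ℕ → Equiv.Perm ℕ → Equiv.Perm ℕ → K) : Prop :=
  ∀ t y : ℕ → K, (∀ j, 1 + β * t j ≠ 0) → (∀ j, 1 + β * y j ≠ 0) →
    ∀ u v : Equiv.Perm ℕ, FinPerm u → FinPerm v →
      {w : Equiv.Perm ℕ | c t y u v w ≠ 0}.Finite ∧
      (∀ w, ¬ FinPerm w → c t y u v w = 0) ∧
      G y u * G t v = ∑ᶠ w : Equiv.Perm ℕ, C (c t y u v w) * G t w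

/-! ### The lattice model / pipe puzzles -/

/-- A state of the `n × n` lattice model: labels in `{0, …, n}` on all horizontal
and vertical (half-)edges.  `sst.1 i j` is the `j`-th horizontal (half-)edge of row
`i` (`j = 0` being the left boundary and `j = n` the right boundary), and
`sst.2 i j` is the `i`-th vertical (half-)edge of column `j` (`i = 0` the top
boundary, `i = n` the bottom boundary). -/
abbrev GridState (n : ℕ) : Type :=
  (Fin n → Fin (n + 1) → Fin (n + 1)) × (Fin (n + 1) → Fin n → Fin (n + 1))

/-- The label on the north edge of the tile in row `i`, column `j`. -/
def labN {n : ℕ} (sst : GridState n) (i j : Fin n) : ℕ := (sst.2 i.castSucc j : ℕ)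
/-- The label on the east edge of the tile in row `i`, column `j`. -/
def labE {n : ℕ} (sst : GridState n) (i j : Fin n) : ℕ := (sst.1 i j.succ : ℕ)
/-- The label on the west edge of the tile in row `i`, column `j`. -/
def labW {n : ℕ} (sst : GridState n) (i j : Fin n) : ℕ := (sst.1 i j.castSucc : ℕ)
/-- The label on the south edge of the tile in row `i`, column `j`. -/
def labS {n : ℕ} (sst : GridState n) (i j : Fin n) : ℕ := (sst.2 i.succ j : ℕ)

/-- Boundary label `κ_u` on the right side (0-based row `i`, 1-based pipe labels). -/
def kappaLab (k : ℕ) (u : Equiv.Perm ℕ) (i : ℕ) : ℕ :=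
  if u⁻¹ i < k then u⁻¹ i + 1 else 0

/-- Boundary label `θ_v` on the top side (0-based column `j`, 1-based pipe labels). -/
def thetaLab (k : ℕ) (v : Equiv.Perm ℕ) (j : ℕ) : ℕ :=
  if k ≤ v⁻¹ j then v⁻¹ j + 1 else 0

/-- Boundary label `η_w` on the bottom side (0-based column `j`, 1-based pipe labels). -/
def etaLab (w : Equiv.Perm ℕ) (j : ℕ) : ℕ := w⁻¹ j + 1

/-- The boundary condition for pipe puzzles for `(u, v, w)`: left edges all `0`,
right edges `κ_u`, top edges `θ_v`, bottom edges `η_w`. -/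
def BoundaryCond (n k : ℕ) (u v w : Equiv.Perm ℕ) (sst : GridState n) : Prop :=
  (∀ i : Fin n, (sst.1 i 0 : ℕ) = 0) ∧
  (∀ i : Fin n, (sst.1 i (Fin.last n) : ℕ) = kappaLab k u (i : ℕ)) ∧
  (∀ j : Fin n, (sst.2 0 j : ℕ) = thetaLab k v (j : ℕ)) ∧
  (∀ j : Fin n, (sst.2 (Fin.last n) j : ℕ) = etaLab w (j : ℕ))

/-- The admissible local configurations (tiles) of a pipe puzzle, in terms of the
four edge labels `N, E, W, S` around a tile:  the empty tile, the vertical pipe,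
the horizontal pipe, the crossing (with the horizontal pipe carrying the smaller
label), the two elbows `⌟` and `⌐` (labels `≤ k` coming from the right side,
labels `> k` from the top side), and the bumping tiles (with the stated label
restrictions). -/
def LAdm (k N E W S : ℕ) : Prop :=
  (N = 0 ∧ E = 0 ∧ W = 0 ∧ S = 0) ∨
  (E = 0 ∧ W = 0 ∧ 0 < N ∧ N = S) ∨
  (N = 0 ∧ S = 0 ∧ 0 < E ∧ E = W) ∨
  (0 < E ∧ E = W ∧ E < N ∧ N = S) ∨
  (E = 0 ∧ S = 0 ∧ 0 < N ∧ N = W ∧ N ≤ k) ∨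
  (E = 0 ∧ S = 0 ∧ N = W ∧ k < N) ∨
  (N = 0 ∧ W = 0 ∧ 0 < E ∧ E = S ∧ E ≤ k) ∨
  (N = 0 ∧ W = 0 ∧ E = S ∧ k < E) ∨
  (0 < E ∧ E = S ∧ E < N ∧ N = W ∧ N ≤ k) ∨
  (k < E ∧ E = S ∧ E < N ∧ N = W) ∨
  (0 < N ∧ N = W ∧ N ≤ k ∧ E = S ∧ k < E)

/-- The admissible local configurations of a Schubert pipe puzzle (no bumping
tiles; crossings have the horizontal pipe carrying the smaller label). -/
def LAdm0 (N E W S : ℕ) : Prop :=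
  (N = 0 ∧ E = 0 ∧ W = 0 ∧ S = 0) ∨
  (E = 0 ∧ W = 0 ∧ 0 < N ∧ N = S) ∨
  (N = 0 ∧ S = 0 ∧ 0 < E ∧ E = W) ∨
  (0 < E ∧ E = W ∧ E < N ∧ N = S) ∨
  (E = 0 ∧ S = 0 ∧ 0 < N ∧ N = W) ∨
  (N = 0 ∧ W = 0 ∧ 0 < E ∧ E = S)

/-- The vertex weight `L(x; N, E, W, S)` of the lattice model (equivalently, the
weight of the corresponding pipe-puzzle tile), with spectral parameter `x`. -/
def Lwt {K : Type*} [Field K] (β : K) (k : ℕ) (x : K) (N E W S : ℕ) : K :=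
  if N = 0 ∧ E = 0 ∧ W = 0 ∧ S = 0 then x
  else if E = 0 ∧ W = 0 ∧ 0 < N ∧ N = S then 1
  else if N = 0 ∧ S = 0 ∧ 0 < E ∧ E = W then 1
  else if 0 < E ∧ E = W ∧ E < N ∧ N = S then 1
  else if E = 0 ∧ S = 0 ∧ 0 < N ∧ N = W ∧ N ≤ k then 1 + β * x
  else if E = 0 ∧ S = 0 ∧ N = W ∧ k < N then 1
  else if N = 0 ∧ W = 0 ∧ 0 < E ∧ E = S ∧ E ≤ k then 1
  else if N = 0 ∧ W = 0 ∧ E = S ∧ k < E then 1 + β * x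
  else if 0 < E ∧ E = S ∧ E < N ∧ N = W ∧ N ≤ k then β
  else if k < E ∧ E = S ∧ E < N ∧ N = W then β
  else if 0 < N ∧ N = W ∧ N ≤ k ∧ E = S ∧ k < E then β * (1 + β * x)
  else 0

/-- The set of pipe puzzles for `(u, v, w)` (with separated-descent parameter `k`),
encoded as admissible states of the lattice model. -/
def PP (n k : ℕ) (u v w : Equiv.Perm ℕ) : Set (GridState n) :=
  {sst | BoundaryCond n k u v w sst ∧
    ∀ i j : Fin n, LAdm k (labN sst i j) (labE sst i j) (labW sst i j) (labS sst i j)}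

/-- The set of Schubert pipe puzzles for `(u, v, w)`. -/
def PP0 (n k : ℕ) (u v w : Equiv.Perm ℕ) : Set (GridState n) :=
  {sst | BoundaryCond n k u v w sst ∧
    ∀ i j : Fin n, LAdm0 (labN sst i j) (labE sst i j) (labW sst i j) (labS sst i j)}

/-- The weight `wt(π)` of a pipe puzzle: the product over all tiles, the tile in
row `i` and column `j` having spectral parameter `t_j ⊖ y_i`. -/
def stateWt {K : Type*} [Field K] (β : K) (k : ℕ) (t y : ℕ → K) {n : ℕ}
    (sst : GridState n) : K :=
  ∏ i : Fin n, ∏ j : Fin n,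
    Lwt β k (ominus β (t (j : ℕ)) (y (i : ℕ)))
      (labN sst i j) (labE sst i j) (labW sst i j) (labS sst i j)

/-- The Schubert weight `wt₀(π)`: the product of `t_j - y_i` over the positions
`(i, j)` of the empty tiles. -/
def stateWt0 {K : Type*} [Field K] (t y : ℕ → K) {n : ℕ} (sst : GridState n) : K :=
  ∏ i : Fin n, ∏ j : Fin n,
    if labN sst i j = 0 ∧ labE sst i j = 0 ∧ labW sst i j = 0 ∧ labS sst i j = 0
    then t (j : ℕ) - y (i : ℕ) else 1

/-! ### The weights of a tile in terms of its incoming labels -/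

/-- Weight of a tile through which the north label passes south and the east label passes west. -/
def passWt {K : Type*} [Field K] (x : K) (N E : ℕ) : K :=
  if E = 0 then (if N = 0 then x else 1) else if N = 0 ∨ E < N then 1 else 0

/-- Weight of a tile in which the north label turns west and the east label turns south. -/
def turnWt {K : Type*} [Field K] (β : K) (k : ℕ) (x : K) (N E : ℕ) : K :=
  if E = 0 then (if N = 0 then 0 else if N ≤ k then 1 + β * x else 1)
  else if N = 0 then (if E ≤ k then 1 else 1 + β * x)
  else if N ≤ k then (if E ≤ k then (if E < N then β else 0) else β * (1 + β * x))
  else if E ≤ k then 0 else if E < N then β else 0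

lemma Lwt_eq_pass_add_turn {K : Type*} [Field K] (β : K) (k : ℕ) (x : K) (N E W S : ℕ) :
    Lwt β k x N E W S =
      (if W = E ∧ S = N then passWt x N E else 0)
        + (if W = N ∧ S = E then turnWt β k x N E else 0) := by
  unfold Lwt passWt turnWt
  grind (splits := 30)

lemma Lwt_eq_zero_of_not_LAdm {K : Type*} [Field K] (β : K) {k : ℕ} (x : K) {N E W S : ℕ}
    (h : ¬ LAdm k N E W S) : Lwt β k x N E W S = 0 := by
  unfold LAdm at h
  unfold Lwt
  grind (splits := 30)

/-! ### The local intertwining relation -/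

/-- Diagonal coefficient of the `R`-matrix on the pair of labels `(a, b)`. -/
def rDiag {K : Type*} (k : ℕ) (p q : K) (a b : ℕ) : K :=
  if a = 0 then (if 0 < b ∧ b ≤ k then q else p)
  else if b = 0 then (if a ≤ k then p else q)
  else if a ≤ b then p else q

/-- Off-diagonal coefficient of the `R`-matrix on the pair of labels `(a, b)`. -/
def rSwap {K : Type*} [Zero K] (r : K) (a b : ℕ) : K := if b < a then r else 0

lemma rDiag_of_le {K : Type*} {k : ℕ} (p q : K) {a b : ℕ} (hab : a ≤ b)
    (h : 0 < a ∨ b = 0 ∨ k < b) : rDiag k p q a b = p := by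
  unfold rDiag
  split_ifs <;> first | rfl | omega

lemma rDiag_of_gt {K : Type*} {k : ℕ} (p q : K) {a b : ℕ} (hab : b < a) (h : 0 < b ∨ k < a) :
    rDiag k p q a b = q := by
  unfold rDiag
  split_ifs <;> first | rfl | omega

/-- The action of a row of two tiles, with parameters `x` and `z`, on a function of the outgoing
labels (south of the left tile, south of the right tile, west). -/
def twoTile {K : Type*} [Field K] (β : K) (k : ℕ) (x z : K) (F : ℕ → ℕ → ℕ → K)
    (a b e : ℕ) : K :=
  passWt z b e * (passWt x a e * F a b e + turnWt β k x a e * F e b a)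
    + turnWt β k z b e * (passWt x a b * F a e b + turnWt β k x a b * F b e a)

set_option maxHeartbeats 4000000 in
lemma twoTile_intertwine {K : Type*} [Field K] (β : K) (k : ℕ) (x z : K)
    (F : ℕ → ℕ → ℕ → K) (a b e : ℕ) :
    rDiag k (1 + β * x) (1 + β * z) a b * twoTile β k z x F a b e
        + rSwap (z - x) a b * twoTile β k z x F b a e =
      twoTile β k x z (fun c d m =>
        rDiag k (1 + β * x) (1 + β * z) c d * F c d m + rSwap (z - x) c d * F d c m) a b e := by
  rcases Nat.eq_zero_or_pos a with ha | ha <;> rcases Nat.eq_zero_or_pos b with hb | hb <;>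
  rcases Nat.eq_zero_or_pos e with he | he <;>
  rcases le_or_gt a k with ha' | ha' <;> rcases le_or_gt b k with hb' | hb' <;>
  rcases le_or_gt e k with he' | he' <;> try omega
  all_goals
    rcases lt_trichotomy a b with hab | hab | hab <;>
    rcases lt_trichotomy a e with hae | hae | hae <;>
    rcases lt_trichotomy b e with hbe | hbe | hbe <;> try omega
  all_goals
    try subst hab
    try subst hae
    try subst hbe
    simp [-mul_eq_mul_left_iff, -mul_eq_mul_right_iff, twoTile, rDiag, rSwap, passWt, turnWt, *, Nat.ne_of_gt, not_le_of_gt, not_lt_of_gt,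
      le_of_lt]
    try ring1

/-! ### Products of matrices as sums over paths -/

lemma list_ofFn_prod_apply {K L : Type*} [Field K] [Fintype L] [DecidableEq L] {m : ℕ}
    (M : Fin m → Matrix L L K) (p q : L) :
    (List.ofFn M).prod p q =
      ∑ h : Fin (m + 1) → L, if h 0 = p ∧ h (Fin.last m) = q then
        ∏ j, M j (h j.castSucc) (h j.succ) else 0 := by
  induction m generalizing p with
  | zero =>
    rw [← (Equiv.funUnique (Fin 1) L).symm.sum_comp]
    simp only [List.ofFn_zero, List.prod_nil, Matrix.one_apply, Finset.univ_eq_empty,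
      Finset.prod_empty]
    by_cases hpq : p = q
    · subst hpq
      simp
    · rw [if_neg hpq, Finset.sum_eq_zero]
      intro a _
      rw [if_neg]
      rintro ⟨h1, h2⟩
      exact hpq (h1.symm.trans h2)
  | succ m ih =>
    rw [List.ofFn_succ, List.prod_cons, Matrix.mul_apply,
      ← (Fin.consEquiv fun _ : Fin (m + 2) => L).sum_comp, Fintype.sum_prod_type]
    symm
    rw [Finset.sum_eq_single p]
    · simp only [ih, Finset.mul_sum]
      rw [Finset.sum_comm]
      refine Finset.sum_congr rfl fun h _ => ?_
      symm
      rw [Finset.sum_eq_single (h 0)]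
      · simp [Fin.consEquiv, Fin.prod_univ_succ, ← Fin.succ_last]
      · intro b _ hb
        simp [hb.symm]
      · simp
    · intro b _ hb
      refine Finset.sum_eq_zero fun h _ => ?_
      simp [Fin.consEquiv, hb]
    · simp

lemma semiconjBy_list_ofFn_prod {M : Type*} [Monoid M] {m : ℕ} {r : M} {f g : Fin m → M}
    (h : ∀ j, SemiconjBy r (f j) (g j)) :
    SemiconjBy r (List.ofFn f).prod (List.ofFn g).prod := by
  induction m with
  | zero => simp
  | succ m ih =>
    rw [List.ofFn_succ, List.ofFn_succ, List.prod_cons, List.prod_cons]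
    exact (h 0).mul_right (ih fun j => h j.succ)

lemma list_ofFn_prod_split {M : Type*} [Monoid M] {m i : ℕ} (hi : i + 1 < m) (f : Fin m → M) :
    (List.ofFn f).prod = ((List.ofFn f).take i).prod *
      (f ⟨i, by omega⟩ * f ⟨i + 1, hi⟩) * ((List.ofFn f).drop (i + 2)).prod := by
  conv_lhs => rw [← List.take_append_drop i (List.ofFn f)]
  rw [List.drop_eq_getElem_cons (by simp; omega), List.drop_eq_getElem_cons (by simp; omega)]
  simp [mul_assoc]

lemma take_list_ofFn_congr {M : Type*} {m i : ℕ} {f g : Fin m → M}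
    (h : ∀ j : Fin m, (j : ℕ) < i → f j = g j) :
    (List.ofFn f).take i = (List.ofFn g).take i := by
  refine List.ext_getElem (by simp) fun j hj _ => ?_
  simp only [List.length_take, List.length_ofFn] at hj
  simpa using h ⟨j, by omega⟩ (by simp; omega)

lemma drop_list_ofFn_congr {M : Type*} {m i : ℕ} {f g : Fin m → M}
    (h : ∀ j : Fin m, i ≤ (j : ℕ) → f j = g j) :
    (List.ofFn f).drop i = (List.ofFn g).drop i := by
  refine List.ext_getElem (by simp) fun j hj _ => ?_
  simp only [List.length_drop, List.length_ofFn] at hj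
  simpa using h ⟨i + j, by omega⟩ (by simp)

/-! ### Length and left multiplication by a simple transposition -/

lemma InSn.inv_lt {n : ℕ} {w : Equiv.Perm ℕ} (hw : InSn n w) {j : ℕ} (hj : j < n) :
    w⁻¹ j < n := by
  by_contra h
  have := hw _ (not_lt.mp h)
  have hj' : w (w⁻¹ j) = j := w.apply_symm_apply j
  omega

lemma InSn.sTr_mul {n i : ℕ} {w : Equiv.Perm ℕ} (hw : InSn n w) (hi : i + 1 < n) :
    InSn n (sTr i * w) := by
  intro j hj
  rw [Equiv.Perm.mul_apply, hw j hj, sTr, Equiv.swap_apply_of_ne_of_ne] <;> omega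

lemma sTr_mul_inv_apply (i j : ℕ) (w : Equiv.Perm ℕ) :
    (sTr i * w)⁻¹ j = w⁻¹ (Equiv.swap i (i + 1) j) := by
  simp [sTr]

lemma len_le_len_sTr_mul {n i : ℕ} {w : Equiv.Perm ℕ} (hw : InSn n w) (hi : i + 1 < n)
    (h : w⁻¹ i < w⁻¹ (i + 1)) : len w ≤ len (sTr i * w) := by
  refine Set.ncard_le_ncard ?_ ?_
  · rintro ⟨p, q⟩ ⟨hpq, hlt⟩
    refine ⟨hpq, ?_⟩
    dsimp only at hpq hlt ⊢
    have hne : ¬ (w q = i ∧ w p = i + 1) := by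
      rintro ⟨hq, hp⟩
      have hp' : w⁻¹ (w p) = p := w.symm_apply_apply p
      have hq' : w⁻¹ (w q) = q := w.symm_apply_apply q
      rw [hp] at hp'
      rw [hq] at hq'
      omega
    simp only [Equiv.Perm.mul_apply, sTr, Equiv.swap_apply_def]
    split_ifs <;> omega
  · refine ((Set.finite_lt_nat n).prod (Set.finite_lt_nat n)).subset ?_
    have hs := hw.sTr_mul hi
    rintro ⟨p, q⟩ ⟨hpq, hlt⟩
    dsimp only at hpq hlt
    have hq : q < n := by
      by_contra hq
      rw [hs q (not_lt.mp hq)] at hlt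
      by_cases hp : p < n
      · have h3 : (sTr i * w) p < n := by
          by_contra h4
          have h5 := (sTr i * w).injective (hs _ (not_lt.mp h4))
          omega
        omega
      · rw [hs p (not_lt.mp hp)] at hlt
        omega
    exact ⟨hpq.trans hq, hq⟩

lemma inv_lt_inv_of_len_lt {n i : ℕ} {w : Equiv.Perm ℕ} (hw : InSn n w) (hi : i + 1 < n)
    (h : len w < len (sTr i * w)) : w⁻¹ i < w⁻¹ (i + 1) := by
  by_contra hlt
  have hne : w⁻¹ i ≠ w⁻¹ (i + 1) := fun he => by simpa using w⁻¹.injective he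
  have hle := len_le_len_sTr_mul (hw.sTr_mul hi) hi (by
    rw [sTr_mul_inv_apply, sTr_mul_inv_apply, Equiv.swap_apply_left, Equiv.swap_apply_right]
    omega)
  rw [← mul_assoc, sTr, Equiv.swap_mul_self, one_mul] at hle
  exact absurd hle (not_le.mpr h)

lemma inv_lt_inv_of_len_gt {n i : ℕ} {w : Equiv.Perm ℕ} (hw : InSn n w) (hi : i + 1 < n)
    (h : len (sTr i * w) < len w) : w⁻¹ (i + 1) < w⁻¹ i := by
  by_contra hlt
  have hne : w⁻¹ i ≠ w⁻¹ (i + 1) := fun he => by simpa using w⁻¹.injective he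
  exact absurd (len_le_len_sTr_mul hw hi (by omega)) (not_le.mpr h)

/-! ### Transfer matrices -/

/-- The matrix of tile weights with fixed north and south labels, indexed by the west and east
labels. -/
def tileMat {K : Type*} [Field K] (β : K) (k n : ℕ) (x : K) (N S : Fin (n + 1)) :
    Matrix (Fin (n + 1)) (Fin (n + 1)) K :=
  Matrix.of fun W E => Lwt β k x N E W S

lemma tileMat_mul_tileMat_apply {K : Type*} [Field K] (β : K) (k n : ℕ) (x z : K)
    (a b c d W E : Fin (n + 1)) :
    (tileMat β k n x a c * tileMat β k n z b d) W E =
      twoTile β k x z (fun c' d' W' => if c' = c ∧ d' = d ∧ W' = W then 1 else 0) a b E := by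
  simp only [Matrix.mul_apply, tileMat, Matrix.of_apply]
  have key : ∀ m : Fin (n + 1), Lwt β k x a m W c * Lwt β k z b E m d =
      (if m = E then (if (d : ℕ) = b then passWt z b E * Lwt β k x a E W c else 0) else 0)
      + (if m = b then (if (d : ℕ) = E then turnWt β k z b E * Lwt β k x a b W c else 0)
        else 0) := by
    intro m
    rw [Lwt_eq_pass_add_turn β k z]
    simp only [Fin.val_inj]
    by_cases h1 : m = E <;> by_cases h2 : m = b <;> by_cases h3 : d = b <;>
      by_cases h4 : d = E <;> simp_all <;> ring
  rw [Finset.sum_congr rfl fun m _ => key m, Finset.sum_add_distrib,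
    Finset.sum_ite_eq' Finset.univ E, Finset.sum_ite_eq' Finset.univ b]
  simp only [Finset.mem_univ, if_true, Lwt_eq_pass_add_turn β k x, twoTile]
  congr 1
  · by_cases h : (d : ℕ) = b
    · simp [h, eq_comm, and_comm]
    · simp [h, Ne.symm h]
  · by_cases h : (d : ℕ) = E
    · simp [h, eq_comm, and_comm]
    · simp [h, Ne.symm h]

lemma tileMat_intertwine {K : Type*} [Field K] (β : K) (k n : ℕ) (x z : K)
    (a b c d : Fin (n + 1)) :
    rDiag k (1 + β * x) (1 + β * z) a b • (tileMat β k n z a c * tileMat β k n x b d)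
        + rSwap (z - x) (a : ℕ) b • (tileMat β k n z b c * tileMat β k n x a d) =
      rDiag k (1 + β * x) (1 + β * z) c d • (tileMat β k n x a c * tileMat β k n z b d)
        + rSwap (z - x) (d : ℕ) c • (tileMat β k n x a d * tileMat β k n z b c) := by
  ext W E
  simp only [Matrix.add_apply, Matrix.smul_apply, smul_eq_mul, tileMat_mul_tileMat_apply]
  rw [twoTile_intertwine]
  have key : ∀ c' d' m : ℕ,
      rDiag k (1 + β * x) (1 + β * z) c' d' *
          (if c' = (c : ℕ) ∧ d' = (d : ℕ) ∧ m = (W : ℕ) then (1 : K) else 0)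
        + rSwap (z - x) c' d' *
          (if d' = (c : ℕ) ∧ c' = (d : ℕ) ∧ m = (W : ℕ) then (1 : K) else 0) =
      rDiag k (1 + β * x) (1 + β * z) c d *
          (if c' = (c : ℕ) ∧ d' = (d : ℕ) ∧ m = (W : ℕ) then (1 : K) else 0)
        + rSwap (z - x) (d : ℕ) c *
          (if c' = (d : ℕ) ∧ d' = (c : ℕ) ∧ m = (W : ℕ) then (1 : K) else 0) := by
    intro c' d' m
    grind
  simp only [twoTile, key]
  ring

/-- The transfer matrix of a row of tiles with parameters `x` and right boundary label `e`. -/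
def rowMat {K : Type*} [Field K] (β : K) (k n : ℕ) (x : Fin n → K) (e : Fin (n + 1)) :
    Matrix (Fin n → Fin (n + 1)) (Fin n → Fin (n + 1)) K :=
  Matrix.of fun a c => (List.ofFn fun j => tileMat β k n (x j) (a j) (c j)).prod 0 e

/-- The matrix with `rDiag` on the diagonal and `rSwap` between label sequences which differ by
exchanging the entries at `i` and `j`. -/
def rMat {K : Type*} [Field K] (k : ℕ) {n : ℕ} (p q r : K) (i j : Fin n) :
    Matrix (Fin n → Fin (n + 1)) (Fin n → Fin (n + 1)) K :=
  Matrix.of fun a c => (if a = c then rDiag k p q (a i) (a j) else 0)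
    + (if a = c ∘ Equiv.swap i j then rSwap r (a i : ℕ) (a j) else 0)

lemma comp_swap_comp_swap {α β : Type*} [DecidableEq α] (a : α → β) (i j : α) :
    (a ∘ Equiv.swap i j) ∘ Equiv.swap i j = a := by
  ext l
  simp

lemma rMat_mul_apply {K : Type*} [Field K] (k : ℕ) {n : ℕ} (p q r : K) (i j : Fin n)
    (V : Matrix (Fin n → Fin (n + 1)) (Fin n → Fin (n + 1)) K) (a c : Fin n → Fin (n + 1)) :
    (rMat k p q r i j * V) a c = rDiag k p q (a i) (a j) * V a c
      + rSwap r (a i : ℕ) (a j) * V (a ∘ Equiv.swap i j) c := by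
  have h : ∀ b : Fin n → Fin (n + 1),
      a = b ∘ Equiv.swap i j ↔ a ∘ Equiv.swap i j = b := fun b => by
    constructor <;> rintro rfl <;> simp [comp_swap_comp_swap]
  simp [Matrix.mul_apply, rMat, add_mul, Finset.sum_add_distrib, h]

lemma mul_rMat_apply {K : Type*} [Field K] (k : ℕ) {n : ℕ} (p q r : K) (i j : Fin n)
    (V : Matrix (Fin n → Fin (n + 1)) (Fin n → Fin (n + 1)) K) (a c : Fin n → Fin (n + 1)) :
    (V * rMat k p q r i j) a c = rDiag k p q (c i) (c j) * V a c
      + rSwap r (c j : ℕ) (c i) * V a (c ∘ Equiv.swap i j) := by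
  simp [Matrix.mul_apply, rMat, mul_add, Finset.sum_add_distrib, mul_comm]

lemma rMat_smul {K : Type*} [Field K] (k : ℕ) {n : ℕ} (s p q r : K) (i j : Fin n) :
    rMat k (s * p) (s * q) (s * r) i j = s • rMat k p q r i j := by
  ext a c
  simp only [rMat, rDiag, rSwap, Matrix.of_apply, Matrix.smul_apply, smul_eq_mul]
  split_ifs <;> ring

lemma rowMat_intertwine {K : Type*} [Field K] (β : K) (k : ℕ) {n i : ℕ} (hi : i + 1 < n)
    (x : Fin n → K) (e : Fin (n + 1)) (i₀ i₁ : Fin n) (h₀ : i₀ = ⟨i, by omega⟩)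
    (h₁ : i₁ = ⟨i + 1, hi⟩) :
    SemiconjBy (rMat k (1 + β * x i₀) (1 + β * x i₁) (x i₁ - x i₀) i₀ i₁)
      (rowMat β k n (x ∘ Equiv.swap i₀ i₁) e) (rowMat β k n x e) := by
  have hne : ∀ j : Fin n, (j : ℕ) < i ∨ i + 2 ≤ (j : ℕ) → Equiv.swap i₀ i₁ j = j := by
    intro j hj
    subst h₀ h₁
    apply Equiv.swap_apply_of_ne_of_ne <;> simp only [ne_eq, Fin.ext_iff] <;> omega
  ext a c
  rw [rMat_mul_apply, mul_rMat_apply]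
  simp only [rowMat, Matrix.of_apply]
  simp only [list_ofFn_prod_split hi, ← h₀, ← h₁]
  have hP : ∀ f : Fin n → Matrix (Fin (n + 1)) (Fin (n + 1)) K,
      (∀ j : Fin n, (j : ℕ) < i ∨ i + 2 ≤ (j : ℕ) →
        f j = tileMat β k n (x j) (a j) (c j)) →
      ∀ g : Matrix (Fin (n + 1)) (Fin (n + 1)) K,
      ((List.ofFn f).take i).prod * g * ((List.ofFn f).drop (i + 2)).prod =
      ((List.ofFn fun j => tileMat β k n (x j) (a j) (c j)).take i).prod * g *
        ((List.ofFn fun j => tileMat β k n (x j) (a j) (c j)).drop (i + 2)).prod := by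
    intro f hf g
    rw [take_list_ofFn_congr fun j hj => hf j (Or.inl hj),
      drop_list_ofFn_congr fun j hj => hf j (Or.inr hj)]
  rw [hP (fun j => tileMat β k n ((x ∘ Equiv.swap i₀ i₁) j) (a j) (c j))
      (fun j hj => by simp [hne j hj]),
    hP (fun j => tileMat β k n ((x ∘ Equiv.swap i₀ i₁) j) ((a ∘ Equiv.swap i₀ i₁) j) (c j))
      (fun j hj => by simp [hne j hj]),
    hP (fun j => tileMat β k n (x j) (a j) ((c ∘ Equiv.swap i₀ i₁) j))
      (fun j hj => by simp [hne j hj])]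
  simp only [Function.comp_apply, Equiv.swap_apply_left, Equiv.swap_apply_right]
  generalize ((List.ofFn fun j => tileMat β k n (x j) (a j) (c j)).take i).prod = P
  generalize ((List.ofFn fun j => tileMat β k n (x j) (a j) (c j)).drop (i + 2)).prod = Q
  have key := congrArg (fun g => (P * g * Q) 0 e)
    (tileMat_intertwine β k n (x i₀) (x i₁) (a i₀) (a i₁) (c i₀) (c i₁))
  simpa [mul_add, add_mul] using key

/-! ### The partition function -/

/-- The partition function of the lattice model with top, right and bottom labels `a`, `κ`, `c`,
as a product of row transfer matrices. -/
def partFn {K : Type*} [Field K] (β : K) (k : ℕ) {n : ℕ} (t y : ℕ → K)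
    (κ : Fin n → Fin (n + 1)) : Matrix (Fin n → Fin (n + 1)) (Fin n → Fin (n + 1)) K :=
  (List.ofFn fun r : Fin n =>
    rowMat β k n (fun j => ominus β (t (j : ℕ)) (y (r : ℕ))) (κ r)).prod

lemma partFn_intertwine {K : Type*} [Field K] (β : K) (k : ℕ) {n i : ℕ} (hi : i + 1 < n)
    (t y : ℕ → K) (hy : ∀ j, 1 + β * y j ≠ 0) (κ : Fin n → Fin (n + 1)) :
    SemiconjBy
      (rMat k (1 + β * t i) (1 + β * t (i + 1)) (t (i + 1) - t i)
        (⟨i, by omega⟩ : Fin n) ⟨i + 1, hi⟩)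
      (partFn β k (swapVal t i) y κ) (partFn β k t y κ) := by
  refine semiconjBy_list_ofFn_prod fun r => ?_
  have hyr := hy r
  have hrow := rowMat_intertwine β k hi (fun j : Fin n => ominus β (t (j : ℕ)) (y (r : ℕ)))
    (κ r) _ _ rfl rfl
  have hx : (fun j : Fin n => ominus β (t (j : ℕ)) (y (r : ℕ))) ∘
      Equiv.swap (⟨i, by omega⟩ : Fin n) ⟨i + 1, hi⟩ =
      fun j : Fin n => ominus β (swapVal t i (j : ℕ)) (y (r : ℕ)) := by
    funext j
    simp only [Function.comp_apply, swapVal, Equiv.swap_apply_def, Fin.ext_iff]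
    split_ifs <;> rfl
  have hR : rMat k (1 + β * t i) (1 + β * t (i + 1)) (t (i + 1) - t i)
      (⟨i, by omega⟩ : Fin n) ⟨i + 1, hi⟩ = (1 + β * y r) •
      rMat k (1 + β * ominus β (t i) (y r)) (1 + β * ominus β (t (i + 1)) (y r))
        (ominus β (t (i + 1)) (y r) - ominus β (t i) (y r))
        (⟨i, by omega⟩ : Fin n) ⟨i + 1, hi⟩ := by
    rw [← rMat_smul]
    congr 1 <;> simp only [ominus] <;> field_simp <;> ring
  rw [hx] at hrow
  rw [hR, SemiconjBy, smul_mul_assoc, mul_smul_comm, hrow.eq]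

lemma partFn_apply {K : Type*} [Field K] (β : K) (k : ℕ) {n : ℕ} (t y : ℕ → K)
    (κ a c : Fin n → Fin (n + 1)) :
    partFn β k t y κ a c = ∑ sst : GridState n,
      if (∀ i, sst.1 i 0 = 0) ∧ (∀ i, sst.1 i (Fin.last n) = κ i) ∧ sst.2 0 = a ∧
        sst.2 (Fin.last n) = c then stateWt β k t y sst else 0 := by
  rw [partFn, list_ofFn_prod_apply, Fintype.sum_prod_type_right]
  refine Finset.sum_congr rfl fun s _ => ?_
  split_ifs with hs
  · simp only [hs, and_true, rowMat, Matrix.of_apply, list_ofFn_prod_apply,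
      Fintype.prod_sum]
    refine Finset.sum_congr rfl fun h _ => ?_
    rw [Finset.prod_ite_zero]
    simp [forall_and, stateWt, tileMat, labN, labE, labW, labS]
  · symm
    refine Finset.sum_eq_zero fun h _ => if_neg ?_
    tauto

lemma finsum_PP_eq_partFn {K : Type*} [Field K] (β : K) {n k : ℕ} {u v w : Equiv.Perm ℕ}
    (t y : ℕ → K) (κ a c : Fin n → Fin (n + 1)) (hκ : ∀ r, (κ r : ℕ) = kappaLab k u r)
    (ha : ∀ j, (a j : ℕ) = thetaLab k v j) (hc : ∀ j, (c j : ℕ) = etaLab w j) :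
    (∑ᶠ π ∈ PP n k u v w, stateWt β k t y π) = partFn β k t y κ a c := by
  classical
  rw [partFn_apply, finsum_mem_def, finsum_eq_sum_of_fintype]
  refine Finset.sum_congr rfl fun π _ => ?_
  have hbc : ((∀ i, π.1 i 0 = 0) ∧ (∀ i, π.1 i (Fin.last n) = κ i) ∧ π.2 0 = a ∧
      π.2 (Fin.last n) = c) ↔ BoundaryCond n k u v w π := by
    simp only [BoundaryCond, funext_iff, Fin.ext_iff, hκ, ha, hc, Fin.val_zero]
  rw [if_congr hbc rfl rfl, Set.indicator_apply]
  by_cases hb : BoundaryCond n k u v w π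
  · by_cases hadm : ∀ i j : Fin n,
        LAdm k (labN π i j) (labE π i j) (labW π i j) (labS π i j)
    · rw [if_pos (show π ∈ PP n k u v w from ⟨hb, hadm⟩), if_pos hb]
    · rw [if_neg (show π ∉ PP n k u v w from fun h => hadm h.2), if_pos hb]
      push Not at hadm
      obtain ⟨i, j, hij⟩ := hadm
      exact (Finset.prod_eq_zero (Finset.mem_univ i) (Finset.prod_eq_zero (Finset.mem_univ j)
        (Lwt_eq_zero_of_not_LAdm β _ hij))).symm
  · rw [if_neg (show π ∉ PP n k u v w from fun h => hb h.1), if_neg hb]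

lemma finsum_PP_recurrence {K : Type*} [Field K] (β : K) {n k : ℕ} {u v w : Equiv.Perm ℕ}
    (hu : InSn n u) (hv : InSn n v) (hw : InSn n w) {i : ℕ} (hi : i + 1 < n)
    (t y : ℕ → K) (hy : ∀ j, 1 + β * y j ≠ 0) :
    rDiag k (1 + β * t i) (1 + β * t (i + 1)) (thetaLab k v i) (thetaLab k v (i + 1)) *
          (∑ᶠ π ∈ PP n k u v w, stateWt β k (swapVal t i) y π)
        + rSwap (t (i + 1) - t i) (thetaLab k v i) (thetaLab k v (i + 1)) *
          (∑ᶠ π ∈ PP n k u (sTr i * v) w, stateWt β k (swapVal t i) y π) =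
      rDiag k (1 + β * t i) (1 + β * t (i + 1)) (etaLab w i) (etaLab w (i + 1)) *
          (∑ᶠ π ∈ PP n k u v w, stateWt β k t y π)
        + rSwap (t (i + 1) - t i) (etaLab w (i + 1)) (etaLab w i) *
          (∑ᶠ π ∈ PP n k u v (sTr i * w), stateWt β k t y π) := by
  let κ : Fin n → Fin (n + 1) := fun r => ⟨kappaLab k u r, by
    have := hu.inv_lt r.2
    unfold kappaLab
    split_ifs <;> omega⟩
  let a : Fin n → Fin (n + 1) := fun r => ⟨thetaLab k v r, by
    have := hv.inv_lt r.2
    unfold thetaLab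
    split_ifs <;> omega⟩
  let c : Fin n → Fin (n + 1) := fun r => ⟨etaLab w r, by
    have := hw.inv_lt r.2
    unfold etaLab
    omega⟩
  have hval : ∀ j : Fin n, ((Equiv.swap (⟨i, by omega⟩ : Fin n) ⟨i + 1, hi⟩ j : Fin n) : ℕ) =
      Equiv.swap i (i + 1) (j : ℕ) := by
    intro j
    simp only [Equiv.swap_apply_def, Fin.ext_iff]
    split_ifs <;> rfl
  rw [finsum_PP_eq_partFn β (swapVal t i) y κ a c (fun _ => rfl) (fun _ => rfl) fun _ => rfl,
    finsum_PP_eq_partFn β t y κ a c (fun _ => rfl) (fun _ => rfl) fun _ => rfl,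
    finsum_PP_eq_partFn β (swapVal t i) y κ
      (a ∘ Equiv.swap (⟨i, by omega⟩ : Fin n) ⟨i + 1, hi⟩) c (fun _ => rfl)
      (fun j => by simp only [Function.comp_apply, a, hval, thetaLab, sTr_mul_inv_apply])
      fun _ => rfl,
    finsum_PP_eq_partFn β t y κ a (c ∘ Equiv.swap (⟨i, by omega⟩ : Fin n) ⟨i + 1, hi⟩)
      (fun _ => rfl) (fun _ => rfl)
      (fun j => by simp only [Function.comp_apply, c, hval, etaLab, sTr_mul_inv_apply])]
  have key := congrFun (congrFun (partFn_intertwine β k hi t y hy κ).eq a) c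
  rwa [rMat_mul_apply, mul_rMat_apply] at key

lemma SepDesc.apply_lt_apply {k : ℕ} {u v : Equiv.Perm ℕ} (h : SepDesc k u v) {p q : ℕ}
    (hpq : p < q) (hq : q < k) : v p < v q := by
  have hle : v p ≤ v q := by
    obtain ⟨d, rfl⟩ := Nat.exists_eq_add_of_lt hpq
    induction d with
    | zero => exact h.2 p hq
    | succ d ih => exact (ih (by omega) (by omega)).trans (h.2 _ (by omega))
  exact lt_of_le_of_ne hle fun he => hpq.ne (v.injective he)

/-- Theorem `thm:indonw` of the paper.  Let `u, v ∈ S_n` have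
separated descents at position `k`, let `w ∈ S_n`, and suppose
`ℓ(s_i w) > ℓ(w)`.  Then the partition function
`Z_{u,v}^w(t,y) = Σ_{π ∈ PP(u,v,w)} wt(π)` satisfies the stated recurrences,
according to whether `ℓ(s_i v) < ℓ(v)` or `ℓ(s_i v) > ℓ(v)`. -/
theorem partition_function_recurrence_in_w
    {K : Type*} [Field K] (β : K)
    (n k : ℕ) (hk : k ≤ n)
    (u v w : Equiv.Perm ℕ) (hu : InSn n u) (hv : InSn n v) (hw : InSn n w)
    (hsep : SepDesc k u v)
    (i : ℕ) (hi : i + 1 < n)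
    (hlen : len w < len (sTr i * w))
    (t y : ℕ → K)
    (ht : ∀ j, 1 + β * t j ≠ 0) (hy : ∀ j, 1 + β * y j ≠ 0)
    (htt : t i ≠ t (i + 1)) :
    (len (sTr i * v) < len v →
      (∑ᶠ π ∈ PP n k u v (sTr i * w), stateWt β k t y π) =
        -((1 + β * t (i + 1)) / (t i - t (i + 1))) *
            (∑ᶠ π ∈ PP n k u v w, stateWt β k (swapVal t i) y π)
          + ((1 + β * t i) / (t i - t (i + 1))) *
              (∑ᶠ π ∈ PP n k u v w, stateWt β k t y π)
          + ∑ᶠ π ∈ PP n k u (sTr i * v) w, stateWt β k (swapVal t i) y π) ∧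
    (len v < len (sTr i * v) →
      (∑ᶠ π ∈ PP n k u v (sTr i * w), stateWt β k t y π) =
        -((1 + β * t i) / (t i - t (i + 1))) *
            (∑ᶠ π ∈ PP n k u v w, stateWt β k (swapVal t i) y π)
          + ((1 + β * t i) / (t i - t (i + 1))) *
              ∑ᶠ π ∈ PP n k u v w, stateWt β k t y π) := by
  have hrec := finsum_PP_recurrence β (k := k) hu hv hw hi t y hy
  have hwi := inv_lt_inv_of_len_lt hw hi hlen
  have hsub : t i - t (i + 1) ≠ 0 := sub_ne_zero.mpr htt
  have hη : etaLab w i < etaLab w (i + 1) := by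
    unfold etaLab
    omega
  rw [rDiag_of_le _ _ hη.le (Or.inl (by simp [etaLab])), rSwap, rSwap, if_pos hη] at hrec
  constructor
  · intro h
    have hvi := inv_lt_inv_of_len_gt hv hi h
    have hkv : k ≤ v⁻¹ i := by
      by_contra hlt
      have := hsep.apply_lt_apply hvi (not_le.mp hlt)
      simp at this
    have hθ : thetaLab k v (i + 1) < thetaLab k v i ∧ k < thetaLab k v i := by
      unfold thetaLab
      split_ifs <;> omega
    rw [rDiag_of_gt _ _ hθ.1 (Or.inr hθ.2), if_pos hθ.1] at hrec
    field_simp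
    linear_combination hrec
  · intro h
    have hvi := inv_lt_inv_of_len_lt hv hi h
    have hθ : thetaLab k v i ≤ thetaLab k v (i + 1) ∧
        (thetaLab k v (i + 1) = 0 ∨ k < thetaLab k v (i + 1)) := by
      unfold thetaLab
      split_ifs <;> omega
    rw [rDiag_of_le _ _ hθ.1 (Or.inr hθ.2), if_neg hθ.1.not_gt] at hrec
    field_simp
    linear_combination hrec
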